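/- Let 𝔽 : ℝ³ → M₃(ℝ) be a smooth matrix field and u : ℝ³ → ℝ³ a smooth divergence-free vector field, all with suitable decay. With ℙ = I − ∇Δ⁻¹ div the Helmholtz (Leray) projection acting on vector fields, the identity ℙ div(u·∇𝔽) = ℙ(u·∇ ℙ div 𝔽) + ℙ(∇u·∇𝔽) − ℙ(∇u·∇Δ⁻¹ div div 𝔽) holds, where [∇u·∇𝔽]_i = Σ_j ∂_j u · ∇𝔽_{ij} and [∇u·∇Δ⁻¹ div div 𝔽]_i = ∂_i u · ∇Δ⁻¹ div div 𝔽. -/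

import Mathlib

open MeasureTheory SchwartzMap
open scoped FourierTransform

noncomputable section

local notation "E3" => EuclideanSpace ℝ (Fin 3)

/-- complex-valued spatial partial derivative `∂ᵢ` on `ℝ³` -/
def pdC (i : Fin 3) (f : E3 → ℂ) (x : E3) : ℂ :=
  fderiv ℝ f x (EuclideanSpace.single i 1)

/-- real-valued spatial partial derivative `∂ᵢ` on `ℝ³` -/
def pdR (i : Fin 3) (f : E3 → ℝ) (x : E3) : ℝ :=
  fderiv ℝ f x (EuclideanSpace.single i 1)

/-- The Leray (Helmholtz) projection `ℙ = I − ∇Δ⁻¹ div`, defined via the Fourier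
multiplier `v̂(ξ) ↦ v̂(ξ) − ξ (ξ·v̂(ξ))/|ξ|²`. -/
def leray (v : Fin 3 → E3 → ℂ) (i : Fin 3) : E3 → ℂ := fun x =>
  v i x - 𝓕⁻ (fun ξ => ((ξ i : ℂ) * ∑ j, (ξ j : ℂ) * 𝓕 (v j) ξ) / ((‖ξ‖ ^ 2 : ℝ) : ℂ)) x

/-- `Δ⁻¹ div div 𝔽`, defined via the Fourier multiplier
`𝔽̂ᵢⱼ(ξ) ↦ (∑ᵢⱼ ξᵢ ξⱼ 𝔽̂ᵢⱼ(ξ))/|ξ|²`. -/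
def invLapDivDiv (F : Fin 3 → Fin 3 → E3 → ℂ) : E3 → ℂ := fun x =>
  𝓕⁻ (fun ξ => (∑ i, ∑ j, (ξ i : ℂ) * (ξ j : ℂ) * 𝓕 (F i j) ξ) / ((‖ξ‖ ^ 2 : ℝ) : ℂ)) x

/-- rapidly decaying measurable functions -/
def RDec (g : E3 → ℂ) : Prop :=
  AEStronglyMeasurable g volume ∧ ∀ n : ℕ, Integrable (fun v => ‖v‖ ^ n * ‖g v‖) volume

def IsS (f : E3 → ℂ) : Prop := ∃ g : SchwartzMap E3 ℂ, ⇑g = f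

lemma RDec.integrable {g : E3 → ℂ} (h : RDec g) : Integrable g := by
  have := h.2 0
  simp only [pow_zero, one_mul] at this
  exact (integrable_norm_iff h.1).1 this

lemma RDec.of_bound {g : E3 → ℂ} (hg : AEStronglyMeasurable g volume) (f : SchwartzMap E3 ℂ)
    (h : ∀ x, ‖g x‖ ≤ ‖f x‖) : RDec g := by
  refine ⟨hg, fun n => ?_⟩
  refine (f.integrable_pow_mul volume n).mono ?_ ?_
  · exact (by fun_prop : AEStronglyMeasurable (fun v : E3 => ‖v‖ ^ n) volume).mul hg.norm
  · filter_upwards with x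
    rw [Real.norm_of_nonneg (by positivity), Real.norm_of_nonneg (by positivity)]
    gcongr
    exact h x

lemma RDec.sum {ι : Type*} (s : Finset ι) {g : ι → E3 → ℂ} (h : ∀ i ∈ s, RDec (g i)) :
    RDec (fun x => ∑ i ∈ s, g i x) := by
  have hm : AEStronglyMeasurable (fun x => ∑ i ∈ s, g i x) volume :=
    Finset.aestronglyMeasurable_fun_sum s (fun i hi => (h i hi).1)
  refine ⟨hm, fun n => ?_⟩
  refine (integrable_finsetSum s (fun i hi => (h i hi).2 n)).mono ?_ ?_
  · exact (by fun_prop : AEStronglyMeasurable (fun v : E3 => ‖v‖ ^ n) volume).mul hm.norm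
  · filter_upwards with x
    rw [Real.norm_of_nonneg (by positivity), Real.norm_of_nonneg (by positivity), ← Finset.mul_sum]
    gcongr
    exact norm_sum_le _ _

lemma coord_le (ξ : E3) (i : Fin 3) : ‖((ξ i : ℝ) : ℂ)‖ ≤ ‖ξ‖ := by
  rw [Complex.norm_real]
  exact PiLp.norm_apply_le ξ i

lemma RDec.mulcoord {g : E3 → ℂ} (h : RDec g) (k : Fin 3) :
    RDec (fun ξ => (2 * Real.pi * Complex.I) * ((ξ k : ℂ) * g ξ)) := by
  have hm : AEStronglyMeasurable (fun ξ : E3 => (2 * Real.pi * Complex.I) * ((ξ k : ℂ) * g ξ))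
      volume := by
    refine AEStronglyMeasurable.const_mul ?_ _
    exact (by fun_prop : Continuous (fun ξ : E3 => (ξ k : ℂ))).aestronglyMeasurable.mul h.1
  refine ⟨hm, fun n => ?_⟩
  refine ((h.2 (n+1)).const_mul ‖(2 * Real.pi * Complex.I)‖).mono ?_ ?_
  · exact (by fun_prop : AEStronglyMeasurable (fun v : E3 => ‖v‖ ^ n) volume).mul hm.norm
  · filter_upwards with x
    rw [Real.norm_of_nonneg (by positivity), Real.norm_of_nonneg (by positivity), norm_mul,
      norm_mul (x k : ℂ)]
    have := coord_le x k
    calc ‖x‖ ^ n * (‖(2 * Real.pi * Complex.I)‖ * (‖(x k : ℂ)‖ * ‖g x‖))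
        ≤ ‖x‖ ^ n * (‖(2 * Real.pi * Complex.I)‖ * (‖x‖ * ‖g x‖)) := by gcongr
      _ = ‖(2 * Real.pi * Complex.I)‖ * (‖x‖ ^ (n + 1) * ‖g x‖) := by ring

lemma RDec.neg {g : E3 → ℂ} (h : RDec g) : RDec (fun x => g (-x)) := by
  refine ⟨h.1.comp_measurePreserving (Measure.measurePreserving_neg volume), fun n => ?_⟩
  simpa using (h.2 n).comp_neg

lemma RDec.tg {g : E3 → ℂ} (h : RDec g) : Function.HasTemperateGrowth (𝓕⁻ g) := by
  rw [Real.fourierInv_eq_fourier_comp_neg]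
  have h' := h.neg
  refine ⟨Real.contDiff_fourier (N := ⊤) (fun n _ => h'.2 n), fun n => ?_⟩
  rw [Real.iteratedFDeriv_fourier (N := ⊤) (fun n _ => h'.2 n) h'.1 (by exact_mod_cast le_top)]
  refine ⟨0, ∫ v, ‖VectorFourier.fourierPowSMulRight (innerSL ℝ) (fun x => g (-x)) v n‖,
    fun x => ?_⟩
  rw [pow_zero, mul_one]
  exact VectorFourier.norm_fourierIntegral_le_integral_norm _ _ _ _ _

lemma RDec.pd {g : E3 → ℂ} (h : RDec g) (k : Fin 3) :
    pdC k (𝓕⁻ g) = 𝓕⁻ (fun ξ => (2 * Real.pi * Complex.I) * ((ξ k : ℂ) * g ξ)) := by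
  have h' := h.neg
  have hi : Integrable (fun v : E3 => ‖v‖ * ‖g (-v)‖) := by simpa using h'.2 1
  rw [Real.fourierInv_eq_fourier_comp_neg, Real.fourierInv_eq_fourier_comp_neg]
  ext x
  rw [pdC, Real.fderiv_fourier h'.integrable hi]
  rw [Real.fourier_eq, Real.fourier_eq]
  rw [ContinuousLinearMap.integral_apply]
  · congr 1
    ext v
    simp [VectorFourier.fourierSMulRight_apply, Circle.smul_def]
    left
    exact (EuclideanSpace.inner_single_right k (1:ℝ) v).trans (by simp)
  · refine (Real.fourierIntegral_convergent_iff x).2 ?_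
    refine (hi.const_mul (2 * Real.pi * ‖(innerSL ℝ : E3 →L[ℝ] E3 →L[ℝ] ℝ)‖)).mono
      h'.1.fourierSMulRight ?_
    filter_upwards with v
    refine (VectorFourier.norm_fourierSMulRight_le _ _ _).trans (le_of_eq ?_)
    rw [Real.norm_of_nonneg (by positivity)]
    ring

lemma isS_leray_mult (i j : Fin 3) {v : E3 → ℂ} (h : IsS v) :
    RDec (fun ξ => ((ξ i : ℂ) * (ξ j : ℂ) * 𝓕 v ξ) / ((‖ξ‖ ^ 2 : ℝ) : ℂ)) := by
  obtain ⟨f, rfl⟩ := h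
  refine RDec.of_bound ?_ (𝓕 f) fun ξ => ?_
  · have : Measurable (𝓕 (f : E3 → ℂ)) := by
      rw [← SchwartzMap.fourier_coe]; exact (𝓕 f).continuous.measurable
    have : Measurable fun ξ : E3 => ((ξ i : ℂ) * (ξ j : ℂ) * 𝓕 (f : E3 → ℂ) ξ) / ((‖ξ‖ ^ 2 : ℝ) : ℂ) := by
      fun_prop
    exact this.aestronglyMeasurable
  · rw [norm_div, norm_mul, norm_mul, Complex.norm_real (‖ξ‖ ^ 2),
      norm_pow, norm_norm, ← SchwartzMap.fourier_coe]
    have h1 := coord_le ξ i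
    have h2 := coord_le ξ j
    apply div_le_of_le_mul₀ (by positivity) (by positivity)
    rw [mul_comm, sq]
    gcongr

lemma IsS.fourier_pd {v : E3 → ℂ} (h : IsS v) (k : Fin 3) (ξ : E3) :
    𝓕 (pdC k v) ξ = (2 * Real.pi * Complex.I) * ((ξ k : ℂ) * 𝓕 v ξ) := by
  obtain ⟨f, rfl⟩ := h
  have h1 := SchwartzMap.fourier_lineDerivOp_eq f (EuclideanSpace.single k 1)
  have h2 := congrArg (fun g : SchwartzMap E3 ℂ => g ξ) h1
  have : (inner ℝ · (EuclideanSpace.single k (1:ℝ) : E3)).HasTemperateGrowth := by fun_prop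
  simp only [smul_apply, SchwartzMap.smulLeftCLM_apply_apply this] at h2
  rw [SchwartzMap.fourier_coe, SchwartzMap.fourier_coe] at h2
  simpa [EuclideanSpace.inner_single_right, SchwartzMap.lineDerivOp_apply_eq_fderiv] using! h2

lemma IsS.pd {v : E3 → ℂ} (h : IsS v) (k : Fin 3) : IsS (pdC k v) := by
  obtain ⟨f, rfl⟩ := h
  exact ⟨LineDeriv.lineDerivOp (EuclideanSpace.single k (1:ℝ) : E3) f, rfl⟩

lemma IsS.sum {ι : Type*} (s : Finset ι) {g : ι → E3 → ℂ} (h : ∀ i, IsS (g i)) :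
    IsS (fun x => ∑ i ∈ s, g i x) := by
  choose f hf using h
  refine ⟨∑ i ∈ s, f i, ?_⟩
  ext x
  simp [← hf]

lemma IsS.add {v w : E3 → ℂ} (h : IsS v) (h' : IsS w) : IsS (fun x => v x + w x) := by
  obtain ⟨f, rfl⟩ := h
  obtain ⟨g, rfl⟩ := h'
  exact ⟨f + g, rfl⟩

lemma IsS.sub {v w : E3 → ℂ} (h : IsS v) (h' : IsS w) : IsS (fun x => v x - w x) := by
  obtain ⟨f, rfl⟩ := h
  obtain ⟨g, rfl⟩ := h'
  exact ⟨f - g, rfl⟩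

lemma IsS.mul {v w : E3 → ℂ} (h : IsS v) (h' : Function.HasTemperateGrowth w) :
    IsS (fun x => v x * w x) := by
  obtain ⟨f, rfl⟩ := h
  refine ⟨SchwartzMap.smulLeftCLM ℂ w f, ?_⟩
  ext x
  simp [SchwartzMap.smulLeftCLM_apply_apply h', mul_comm]

lemma IsS.tg {v : E3 → ℂ} (h : IsS v) : Function.HasTemperateGrowth v := by
  obtain ⟨f, rfl⟩ := h
  exact f.hasTemperateGrowth

lemma IsS.integrable {v : E3 → ℂ} (h : IsS v) : Integrable v := by
  obtain ⟨f, rfl⟩ := h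
  exact f.integrable

lemma isS_ofReal (f : SchwartzMap E3 ℝ) : IsS (fun x => ((f x : ℝ) : ℂ)) :=
  ⟨SchwartzMap.postcompCLM Complex.ofRealCLM f, rfl⟩

lemma fourier_addE {f g : E3 → ℂ} (hf : Integrable f) (hg : Integrable g) :
    𝓕 (fun x => f x + g x) = fun ξ => 𝓕 f ξ + 𝓕 g ξ := by
  ext ξ
  simp only [Real.fourier_eq]
  rw [← integral_add ((Real.fourierIntegral_convergent_iff ξ).2 hf)
    ((Real.fourierIntegral_convergent_iff ξ).2 hg)]
  simp only [smul_add]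

lemma fourierInv_addE {f g : E3 → ℂ} (hf : Integrable f) (hg : Integrable g) (x : E3) :
    𝓕⁻ (fun x => f x + g x) x = 𝓕⁻ f x + 𝓕⁻ g x := by
  simp only [Real.fourierInv_eq_fourier_neg]
  rw [fourier_addE hf hg]

lemma leray_symb {v : Fin 3 → E3 → ℂ} (h : ∀ i, IsS (v i)) (i : Fin 3) :
    RDec (fun ξ => ((ξ i : ℂ) * ∑ j, (ξ j : ℂ) * 𝓕 (v j) ξ) / ((‖ξ‖ ^ 2 : ℝ) : ℂ)) := by
  have := RDec.sum Finset.univ (fun j _ => isS_leray_mult i j (h j))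
  simpa only [Finset.mul_sum, Finset.sum_div, ← mul_assoc] using this

lemma leray_add {v w : Fin 3 → E3 → ℂ} (hv : ∀ i, IsS (v i)) (hw : ∀ i, IsS (w i)) (i : Fin 3)
    (x : E3) : leray (fun i x => v i x + w i x) i x = leray v i x + leray w i x := by
  have e : (fun ξ : E3 => ((ξ i : ℂ) * ∑ j, (ξ j : ℂ) * 𝓕 (fun x => v j x + w j x) ξ) /
      ((‖ξ‖ ^ 2 : ℝ) : ℂ)) = fun ξ : E3 =>
      ((ξ i : ℂ) * ∑ j, (ξ j : ℂ) * 𝓕 (v j) ξ) / ((‖ξ‖ ^ 2 : ℝ) : ℂ) +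
      ((ξ i : ℂ) * ∑ j, (ξ j : ℂ) * 𝓕 (w j) ξ) / ((‖ξ‖ ^ 2 : ℝ) : ℂ) := by
    ext ξ
    simp only [fun j => fourier_addE (hv j).integrable (hw j).integrable, mul_add,
      Finset.sum_add_distrib, add_div]
  simp only [leray]
  rw [e, fourierInv_addE (leray_symb hv i).integrable (leray_symb hw i).integrable]
  ring

lemma leray_grad {q : E3 → ℂ} (hq : IsS q) (i : Fin 3) (x : E3) :
    leray (fun i => pdC i q) i x = 0 := by
  have e : (fun ξ : E3 => ((ξ i : ℂ) * ∑ j, (ξ j : ℂ) * 𝓕 (pdC j q) ξ) /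
      ((‖ξ‖ ^ 2 : ℝ) : ℂ)) = 𝓕 (pdC i q) := by
    ext ξ
    simp only [hq.fourier_pd]
    rcases eq_or_ne ξ 0 with rfl | h0
    · simp
    · have hn : ((‖ξ‖ ^ 2 : ℝ) : ℂ) ≠ 0 := by
        exact_mod_cast pow_ne_zero 2 (norm_ne_zero_iff.2 h0)
      rw [div_eq_iff hn, EuclideanSpace.real_norm_sq_eq]
      simp only [Fin.sum_univ_three]
      push_cast
      ring
  obtain ⟨g, hg⟩ := hq.pd i
  simp only [leray]
  rw [e, ← hg, ← SchwartzMap.fourier_coe, ← SchwartzMap.fourierInv_coe,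
    FourierTransform.fourierInv_fourier_eq]
  simp

lemma symb_P {F : Fin 3 → Fin 3 → E3 → ℂ} (h : ∀ i j, IsS (F i j)) :
    RDec (fun ξ => (∑ i, ∑ j, (ξ i : ℂ) * (ξ j : ℂ) * 𝓕 (F i j) ξ) / ((‖ξ‖ ^ 2 : ℝ) : ℂ)) := by
  have := RDec.sum Finset.univ (fun i _ => RDec.sum Finset.univ
    (fun j _ => isS_leray_mult i j (h i j)))
  simpa only [Finset.sum_div] using this

lemma fourier_sumE {f : Fin 3 → E3 → ℂ} (hf : ∀ j, Integrable (f j)) (ξ : E3) :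
    𝓕 (fun x => ∑ j, f j x) ξ = ∑ j, 𝓕 (f j) ξ := by
  simp only [Real.fourier_eq]
  rw [← integral_finsetSum _ (fun j _ => (Real.fourierIntegral_convergent_iff ξ).2 (hf j))]
  simp only [Finset.smul_sum]

lemma leray_divF {F : Fin 3 → Fin 3 → E3 → ℂ} (h : ∀ i j, IsS (F i j)) (i : Fin 3) :
    leray (fun l y => ∑ j, pdC j (F l j) y) i =
      fun x => ∑ j, pdC j (F i j) x - pdC i (invLapDivDiv F) x := by
  ext x
  have : invLapDivDiv F = 𝓕⁻ (fun ξ : E3 => (∑ i, ∑ j, (ξ i : ℂ) * (ξ j : ℂ) * 𝓕 (F i j) ξ) /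
      ((‖ξ‖ ^ 2 : ℝ) : ℂ)) := rfl
  rw [this, (symb_P h).pd]
  simp only [leray]
  congr 1
  refine congrFun (congrArg _ ?_) x
  ext ξ
  have e : ∀ l, 𝓕 (fun y => ∑ j, pdC j (F l j) y) ξ = ∑ j, 𝓕 (pdC j (F l j)) ξ :=
    fun l => fourier_sumE (fun j => ((h l j).pd j).integrable) ξ
  simp only [e, fun l j k => (h l j).fourier_pd k]
  simp only [Fin.sum_univ_three]
  ring

lemma pdC_mul {f g : E3 → ℂ} (hf : Differentiable ℝ f) (hg : Differentiable ℝ g) (k : Fin 3)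
    (x : E3) : pdC k (fun y => f y * g y) x = pdC k f x * g x + f x * pdC k g x := by
  simp only [pdC]
  rw [fderiv_fun_mul (hf x) (hg x)]
  simp
  ring

lemma pdC_sum {f : Fin 3 → E3 → ℂ} (hf : ∀ j, Differentiable ℝ (f j)) (k : Fin 3)
    (x : E3) : pdC k (fun y => ∑ j, f j y) x = ∑ j, pdC k (f j) x := by
  simp only [pdC]
  rw [fderiv_fun_sum (fun j _ => hf j x)]
  simp

lemma pdC_sub {f g : E3 → ℂ} (hf : Differentiable ℝ f) (hg : Differentiable ℝ g) (k : Fin 3)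
    (x : E3) : pdC k (fun y => f y - g y) x = pdC k f x - pdC k g x := by
  simp only [pdC]
  rw [fderiv_fun_sub (hf x) (hg x)]
  simp

lemma pdC_diff {f : E3 → ℂ} (hf : ContDiff ℝ 2 f) (k : Fin 3) : Differentiable ℝ (pdC k f) := by
  have : Differentiable ℝ (fderiv ℝ f) :=
    (hf.fderiv_right (m := 1) (by norm_num)).differentiable (by norm_num)
  unfold pdC
  fun_prop

lemma pdC_comm {f : E3 → ℂ} (hf : ContDiff ℝ 2 f) (k l : Fin 3) (x : E3) :
    pdC k (pdC l f) x = pdC l (pdC k f) x := by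
  have hd : Differentiable ℝ (fderiv ℝ f) :=
    (hf.fderiv_right (m := 1) (by norm_num)).differentiable (by norm_num)
  have key : ∀ a b : Fin 3, pdC a (pdC b f) x =
      fderiv ℝ (fderiv ℝ f) x (EuclideanSpace.single a 1) (EuclideanSpace.single b 1) := by
    intro a b
    change fderiv ℝ (fun y => fderiv ℝ f y (EuclideanSpace.single b 1)) x _ = _
    rw [fderiv_clm_apply (hd x) (by fun_prop)]
    simp
  rw [key, key]
  exact (hf.contDiffAt.isSymmSndFDerivAt (by simp)) _ _

lemma pdR_ofReal (f : SchwartzMap E3 ℝ) (k : Fin 3) (x : E3) :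
    ((pdR k f x : ℝ) : ℂ) = pdC k (fun y => ((f y : ℝ) : ℂ)) x := by
  have := (Complex.ofRealCLM.hasFDerivAt.comp x (f.differentiableAt (x := x)).hasFDerivAt).fderiv
  simp only [pdC, pdR]
  change _ = fderiv ℝ (Complex.ofRealCLM ∘ f) x _
  rw [this]
  simp

theorem stmt4 (u : Fin 3 → SchwartzMap E3 ℝ) (F : Fin 3 → Fin 3 → SchwartzMap E3 ℝ)
    (hdiv : ∀ x, ∑ k, pdR k (u k) x = 0) :
    ∀ i x,
      leray (fun i' x' =>
          ∑ j, pdC j (fun y => ∑ k, ((u k y : ℝ) : ℂ) *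
            pdC k (fun z => ((F i' j z : ℝ) : ℂ)) y) x') i x =
        leray (fun i' x' => ∑ k, ((u k x' : ℝ) : ℂ) *
            pdC k (leray (fun l => fun y => ∑ j, pdC j (fun z => ((F l j z : ℝ) : ℂ)) y) i') x') i x
          + leray (fun i' x' => ∑ j, ∑ k, ((pdR j (u k) x' : ℝ) : ℂ) *
              pdC k (fun z => ((F i' j z : ℝ) : ℂ)) x') i x
          - leray (fun i' x' => ∑ k, ((pdR i' (u k) x' : ℝ) : ℂ) *
              pdC k (invLapDivDiv (fun a b z => ((F a b z : ℝ) : ℂ))) x') i x := by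
  intro i x
  have hU : ∀ k, IsS (fun y => ((u k y : ℝ) : ℂ)) := fun k => isS_ofReal (u k)
  have hF : ∀ a b, IsS (fun y => ((F a b y : ℝ) : ℂ)) := fun a b => isS_ofReal (F a b)
  simp only [pdR_ofReal]
  generalize hUd : (fun k y => ((u k y : ℝ) : ℂ)) = U at hU
  generalize hFd : (fun a b y => ((F a b y : ℝ) : ℂ)) = G at hF
  have hU' : ∀ k, (fun y => ((u k y : ℝ) : ℂ)) = U k := fun k => congrFun hUd k
  have hU2 : ∀ k y, ((u k y : ℝ) : ℂ) = U k y := fun k y => congrFun (congrFun hUd k) y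
  have hF2 : ∀ a b y, ((F a b y : ℝ) : ℂ) = G a b y := fun a b y => by rw [← hFd]
  simp only [hU2, hF2] at hU hF ⊢
  change leray (fun i' x' => ∑ j, pdC j (fun y => ∑ k, U k y * pdC k (G i' j) y) x') i x =
        leray (fun i' x' => ∑ k, U k x' *
            pdC k (leray (fun l => fun y => ∑ j, pdC j (G l j) y) i') x') i x
          + leray (fun i' x' => ∑ j, ∑ k, pdC j (U k) x' * pdC k (G i' j) x') i x
          - leray (fun i' x' => ∑ k, pdC i' (U k) x' * pdC k (invLapDivDiv G) x') i x
  have hF : ∀ a b, IsS (G a b) := hF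
  have hU : ∀ k, IsS (U k) := hU
  simp only [leray_divF hF]
  have hP : RDec _ := symb_P hF
  obtain ⟨P, hPd⟩ : ∃ P, P = invLapDivDiv G := ⟨_, rfl⟩
  have hPe : P = 𝓕⁻ (fun ξ : E3 => (∑ i, ∑ j, (ξ i : ℂ) * (ξ j : ℂ) * 𝓕 (G i j) ξ) /
      ((‖ξ‖ ^ 2 : ℝ) : ℂ)) := hPd
  rw [← hPd]
  have hPt : Function.HasTemperateGrowth P := by rw [hPe]; exact hP.tg
  have hP1 : ∀ k, Function.HasTemperateGrowth (pdC k P) := fun k => by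
    rw [hPe, hP.pd]; exact (hP.mulcoord k).tg
  have hP2 : ∀ k l, Function.HasTemperateGrowth (pdC k (pdC l P)) := fun k l => by
    rw [hPe, hP.pd, (hP.mulcoord l).pd]; exact ((hP.mulcoord l).mulcoord k).tg
  have c2 : ∀ {f : E3 → ℂ}, Function.HasTemperateGrowth f → ContDiff ℝ 2 f :=
    fun h => h.1.of_le (WithTop.coe_le_coe.2 le_top)
  have dd : ∀ {f : E3 → ℂ}, Function.HasTemperateGrowth f → Differentiable ℝ f :=
    fun h => (c2 h).differentiable (by norm_num)
  have hq : IsS (fun y => ∑ k, U k y * pdC k P y) :=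
    IsS.sum _ fun k => (hU k).mul (hP1 k)
  have e2 : ∀ k i' x', pdC k (fun y => ∑ j, pdC j (G i' j) y - pdC i' P y) x' =
      ∑ j, pdC k (pdC j (G i' j)) x' - pdC k (pdC i' P) x' := fun k i' x' => by
    rw [pdC_sub (dd (IsS.sum _ fun j => (hF i' j).pd j).tg) (dd (hP1 i')),
      pdC_sum fun j => dd ((hF i' j).pd j).tg]
  simp only [e2]
  have h1 : ∀ i', IsS (fun x' => ∑ j, pdC j (fun y => ∑ k, U k y * pdC k (G i' j) y) x') :=
    fun i' => IsS.sum _ fun j =>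
      (IsS.sum _ fun k => (hU k).mul ((hF i' j).pd k).tg).pd j
  have h2 : ∀ i', IsS (fun x' => ∑ k, U k x' *
      (∑ j, pdC k (pdC j (G i' j)) x' - pdC k (pdC i' P) x')) := fun i' =>
    IsS.sum _ fun k => (hU k).mul
      ((IsS.sum _ fun j => ((hF i' j).pd j).pd k).tg.sub (hP2 k i'))
  have h3 : ∀ i', IsS (fun x' => ∑ j, ∑ k, pdC j (U k) x' * pdC k (G i' j) x') := fun i' =>
    IsS.sum _ fun j => IsS.sum _ fun k => ((hU k).pd j).mul ((hF i' j).pd k).tg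
  have h4 : ∀ i', IsS (fun x' => ∑ k, pdC i' (U k) x' * pdC k P x') := fun i' =>
    IsS.sum _ fun k => ((hU k).pd i').mul (hP1 k)
  have L1 := leray_add h1 h4 i x
  have L2 := leray_add h2 h3 i x
  have L3 := leray_add (fun i => (h2 i).add (h3 i)) (fun i => hq.pd i) i x
  rw [leray_grad hq, L2] at L3
  rw [eq_sub_iff_add_eq, ← L1, ← add_zero (_ + _), ← L3]
  congr 1
  ext i' y
  have m1 : pdC i' (fun y => ∑ k, U k y * pdC k P y) y =
      ∑ k, (pdC i' (U k) y * pdC k P y + U k y * pdC k (pdC i' P) y) := by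
    rw [pdC_sum (f := fun k y => U k y * pdC k P y) fun k => (dd (hU k).tg).mul (dd (hP1 k))]
    refine Finset.sum_congr rfl fun k _ => ?_
    rw [pdC_mul (dd (hU k).tg) (dd (hP1 k)), pdC_comm (c2 hPt) i' k]
  have m2 : ∀ j, pdC j (fun y => ∑ k, U k y * pdC k (G i' j) y) y =
      ∑ k, (pdC j (U k) y * pdC k (G i' j) y + U k y * pdC k (pdC j (G i' j)) y) := fun j => by
    rw [pdC_sum (f := fun k y => U k y * pdC k (G i' j) y)
      fun k => (dd (hU k).tg).mul (dd ((hF i' j).pd k).tg)]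
    refine Finset.sum_congr rfl fun k _ => ?_
    rw [pdC_mul (dd (hU k).tg) (dd ((hF i' j).pd k).tg), pdC_comm (c2 (hF i' j).tg) j k]
  rw [m1]
  simp only [m2]
  simp only [Fin.sum_univ_three]
  ring

end
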